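/- Assume Condition 2 and Condition 4. Then there exist two items (q₁,q₂,t), (q₁',q₂',t') ∈ [0,1]² × ℝ such that u(x,y) = max(0, q₁x + q₂y − t, q₁'x + q₂'y − t') is an optimal feasible utility function (so the optimal mechanism has at most 3 menu items), and consequently bundling 2-approximates the optimal revenue: 2·BRev ≥ sup over feasible utility functions u of R(u). -/

import Mathlib

open MeasureTheory Set

noncomputable section

/-- A positive, bounded, differentiable density on `[a,b]` integrating to 1. -/
def Density (a b : ℝ) (h : ℝ → ℝ) : Prop :=
  (∀ x ∈ Set.Icc a b, 0 < h x) ∧ (∃ M, ∀ x ∈ Set.Icc a b, h x ≤ M) ∧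
  (∀ x ∈ Set.Icc a b, DifferentiableAt ℝ h x) ∧ (∫ x in a..b, h x) = 1

/-- The valuation rectangle `V = [xA,xB] × [yA,yC]`. -/
def V (xA xB yA yC : ℝ) : Set (ℝ × ℝ) := Set.Icc (xA, yA) (xB, yC)

/-- First partial derivative. -/
def pd1 (u : ℝ × ℝ → ℝ) (z : ℝ × ℝ) : ℝ := fderiv ℝ u z (1, 0)

/-- Second partial derivative. -/
def pd2 (u : ℝ × ℝ → ℝ) (z : ℝ × ℝ) : ℝ := fderiv ℝ u z (0, 1)

/-- A feasible buyer utility function: nonnegative, convex, with increments in each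
coordinate between `0` and the coordinate increment (partial derivatives in `[0,1]`). -/
def Feasible (xA xB yA yC : ℝ) (u : ℝ × ℝ → ℝ) : Prop :=
  (∀ z ∈ V xA xB yA yC, 0 ≤ u z) ∧
  ConvexOn ℝ (V xA xB yA yC) u ∧
  (∀ x x' y, xA ≤ x → x ≤ x' → x' ≤ xB → y ∈ Set.Icc yA yC →
    0 ≤ u (x', y) - u (x, y) ∧ u (x', y) - u (x, y) ≤ x' - x) ∧
  (∀ x y y', x ∈ Set.Icc xA xB → yA ≤ y → y ≤ y' → y' ≤ yC →
    0 ≤ u (x, y') - u (x, y) ∧ u (x, y') - u (x, y) ≤ y' - y)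

/-- The seller's expected revenue from utility function `u` under joint density
`f₁(x)·f₂(y)`. -/
def Rev (xA xB yA yC : ℝ) (f1 f2 : ℝ → ℝ) (u : ℝ × ℝ → ℝ) : ℝ :=
  ∫ z in V xA xB yA yC, (z.1 * pd1 u z + z.2 * pd2 u z - u z) * (f1 z.1 * f2 z.2)

/-- The optimal revenue: supremum of revenue over feasible utility functions. -/
def OptRev (xA xB yA yC : ℝ) (f1 f2 : ℝ → ℝ) : ℝ :=
  sSup {r | ∃ u, Feasible xA xB yA yC u ∧ r = Rev xA xB yA yC f1 f2 u}

/-- A feasible utility function is optimal if its revenue attains the supremum. -/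
def Optimal (xA xB yA yC : ℝ) (f1 f2 : ℝ → ℝ) (u : ℝ × ℝ → ℝ) : Prop :=
  Feasible xA xB yA yC u ∧ Rev xA xB yA yC f1 f2 u = OptRev xA xB yA yC f1 f2

/-- The power rate of a density `h`: `PR(h)(x) = x·h'(x)/h(x)`. -/
def PR (h : ℝ → ℝ) (x : ℝ) : ℝ := x * deriv h x / h x

/-- The bundling revenue `BRev = sup_{p ≥ 0} p · ∫_{x+y ≥ p} f`. -/
def BRev (xA xB yA yC : ℝ) (f1 f2 : ℝ → ℝ) : ℝ :=
  sSup {r | ∃ p, 0 ≤ p ∧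
    r = p * ∫ z in {z ∈ V xA xB yA yC | p ≤ z.1 + z.2}, f1 z.1 * f2 z.2}

/-- The payment associated with utility `u` at a point of differentiability. -/
def pay (u : ℝ × ℝ → ℝ) (z : ℝ × ℝ) : ℝ := pd1 u z * z.1 + pd2 u z * z.2 - u z

/-- Lebesgue measure on the interval `[a,b]`. -/
abbrev ivol (a b : ℝ) : Measure ℝ := volume.restrict (Icc a b)

/-- The derivative of `x ↦ x * h x`. -/
def mulIdDeriv (h : ℝ → ℝ) (x : ℝ) : ℝ := deriv (fun s => s * h s) x

/-- A density on a nondegenerate interval with bounded power rate. -/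
structure BoundedPR (a b : ℝ) (h : ℝ → ℝ) : Prop where
  lt : a < b
  dens : Density a b h
  bdd : ∃ C, ∀ x ∈ Icc a b, |PR h x| ≤ C

lemma restrict_V (xA xB yA yC : ℝ) :
    (volume : Measure (ℝ × ℝ)).restrict (V xA xB yA yC) = (ivol xA xB).prod (ivol yA yC) := by
  rw [V, Icc_prod_eq, Measure.prod_restrict]; rfl

lemma mem_V {xA xB yA yC x y : ℝ} :
    (x, y) ∈ V xA xB yA yC ↔ x ∈ Icc xA xB ∧ y ∈ Icc yA yC := by
  rw [V, Icc_prod_eq]; rfl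

lemma ContinuousOn.memLp_top_restrict {E : Type*} [TopologicalSpace E] [T2Space E]
    [MeasurableSpace E] [BorelSpace E]
    {μ : Measure E} {s : Set E} {f : E → ℝ} (hf : ContinuousOn f s) (hs : IsCompact s) :
    MemLp f ⊤ (μ.restrict s) := by
  obtain ⟨C, hC⟩ := hs.exists_bound_of_continuousOn hf
  refine memLp_top_of_bound (hf.aestronglyMeasurable_of_isCompact hs hs.measurableSet) C ?_
  exact (ae_restrict_iff' hs.measurableSet).2 (.of_forall hC)

lemma memLp_top_mul {α : Type*} [MeasurableSpace α] {μ : Measure α} {f g : α → ℝ}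
    (hf : MemLp f ⊤ μ) (hg : MemLp g ⊤ μ) : MemLp (fun x => f x * g x) ⊤ μ :=
  hg.mul hf

namespace BoundedPR

variable {a b : ℝ} {h : ℝ → ℝ}

lemma continuousOn (H : BoundedPR a b h) : ContinuousOn h (Icc a b) :=
  fun x hx => (H.dens.2.2.1 x hx).continuousAt.continuousWithinAt

lemma memLp (H : BoundedPR a b h) : MemLp h ⊤ (ivol a b) :=
  H.continuousOn.memLp_top_restrict isCompact_Icc

lemma mulIdDeriv_eq (H : BoundedPR a b h) {x : ℝ} (hx : x ∈ Icc a b) :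
    mulIdDeriv h x = h x * (1 + PR h x) := by
  have h1 := H.dens.1 x hx
  have h2 := ((hasDerivAt_id x).mul (H.dens.2.2.1 x hx).hasDerivAt).deriv
  have h3 : mulIdDeriv h x = 1 * h x + x * deriv h x := h2
  rw [h3, PR]
  field_simp

lemma exists_mulIdDeriv_bound (H : BoundedPR a b h) :
    ∃ C, ∀ x ∈ Icc a b, ‖mulIdDeriv h x‖ ≤ C := by
  obtain ⟨C, hC⟩ := H.bdd
  obtain ⟨M, hM⟩ := H.dens.2.1
  refine ⟨M * (1 + C), fun x hx => ?_⟩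
  rw [H.mulIdDeriv_eq hx, Real.norm_eq_abs, abs_mul, abs_of_pos (H.dens.1 x hx)]
  have h1 : |1 + PR h x| ≤ 1 + C := (abs_add_le _ _).trans (by simpa using hC x hx)
  exact mul_le_mul (hM x hx) h1 (abs_nonneg _) ((H.dens.1 x hx).le.trans (hM x hx))

lemma memLp_mulIdDeriv (H : BoundedPR a b h) : MemLp (mulIdDeriv h) ⊤ (ivol a b) := by
  obtain ⟨C, hC⟩ := H.exists_mulIdDeriv_bound
  exact memLp_top_of_bound (measurable_deriv _).aestronglyMeasurable C
    ((ae_restrict_iff' measurableSet_Icc).2 (.of_forall hC))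

lemma absolutelyContinuous_mul_id (H : BoundedPR a b h) :
    AbsolutelyContinuousOnInterval (fun s => s * h s) a b := by
  obtain ⟨C, hC⟩ := H.exists_mulIdDeriv_bound
  have : LipschitzOnWith C.toNNReal (fun s => s * h s) (uIcc a b) := by
    rw [uIcc_of_le H.lt.le]
    refine Convex.lipschitzOnWith_of_nnnorm_deriv_le (𝕜 := ℝ)
      (fun x hx => differentiableAt_id.mul (H.dens.2.2.1 x hx)) (fun x hx => ?_) (convex_Icc a b)
    exact NNReal.coe_le_coe.1 ((hC x hx).trans (Real.le_coe_toNNReal C))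
  exact this.absolutelyContinuousOnInterval

lemma integral_mul_id_mul_deriv (H : BoundedPR a b h) {v : ℝ → ℝ} {K : NNReal}
    (hv : LipschitzOnWith K v (Icc a b)) :
    ∫ y, y * h y * deriv v y ∂(ivol a b)
      = b * h b * v b - a * h a * v a - ∫ y, mulIdDeriv h y * v y ∂(ivol a b) := by
  rw [integral_Icc_eq_integral_Ioc, integral_Icc_eq_integral_Ioc,
    ← intervalIntegral.integral_of_le H.lt.le, ← intervalIntegral.integral_of_le H.lt.le]
  rw [← uIcc_of_le H.lt.le] at hv
  exact H.absolutelyContinuous_mul_id.integral_mul_deriv_eq_deriv_mul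
    hv.absolutelyContinuousOnInterval

lemma integral_eq_one (H : BoundedPR a b h) : ∫ x, h x ∂(ivol a b) = 1 := by
  rw [integral_Icc_eq_integral_Ioc, ← intervalIntegral.integral_of_le H.lt.le]
  exact H.dens.2.2.2

lemma integral_mulIdDeriv (H : BoundedPR a b h) :
    ∫ x, mulIdDeriv h x ∂(ivol a b) = b * h b - a * h a := by
  have := H.integral_mul_id_mul_deriv (v := fun _ => 1) (K := 0)
    (LipschitzWith.const 1).lipschitzOnWith
  simp at this
  linarith

end BoundedPR

section FeasibleFacts

variable {xA xB yA yC : ℝ} {u : ℝ × ℝ → ℝ}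

lemma Feasible.abs_sub_le (hu : Feasible xA xB yA yC u) {x x' y y' : ℝ} (hx : x ∈ Icc xA xB)
    (hx' : x' ∈ Icc xA xB) (hy : y ∈ Icc yA yC) (hy' : y' ∈ Icc yA yC) :
    |u (x, y) - u (x', y')| ≤ |x - x'| + |y - y'| := by
  have h1 : |u (x, y) - u (x', y)| ≤ |x - x'| := by
    rcases le_total x x' with h | h
    · have := hu.2.2.1 x x' y hx.1 h hx'.2 hy
      rw [abs_sub_comm, abs_sub_comm x, abs_of_nonneg this.1, abs_of_nonneg (by linarith)]
      exact this.2
    · have := hu.2.2.1 x' x y hx'.1 h hx.2 hy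
      rw [abs_of_nonneg this.1, abs_of_nonneg (by linarith)]
      exact this.2
  have h2 : |u (x', y) - u (x', y')| ≤ |y - y'| := by
    rcases le_total y y' with h | h
    · have := hu.2.2.2 x' y y' hx' hy.1 h hy'.2
      rw [abs_sub_comm, abs_sub_comm y, abs_of_nonneg this.1, abs_of_nonneg (by linarith)]
      exact this.2
    · have := hu.2.2.2 x' y' y hx' hy'.1 h hy.2
      rw [abs_of_nonneg this.1, abs_of_nonneg (by linarith)]
      exact this.2
  calc _ = |(u (x, y) - u (x', y)) + (u (x', y) - u (x', y'))| := by ring_nf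
    _ ≤ _ := (abs_add_le _ _).trans (add_le_add h1 h2)

lemma Feasible.lipschitzOnWith (hu : Feasible xA xB yA yC u) :
    LipschitzOnWith 2 u (V xA xB yA yC) := by
  refine LipschitzOnWith.of_dist_le_mul fun z hz z' hz' => ?_
  obtain ⟨x, y⟩ := z
  obtain ⟨x', y'⟩ := z'
  rw [mem_V] at hz hz'
  have h := hu.abs_sub_le hz.1 hz'.1 hz.2 hz'.2
  have h1 := le_max_left |x - x'| |y - y'|
  have h2 := le_max_right |x - x'| |y - y'|
  rw [Real.dist_eq, Prod.dist_eq, Real.dist_eq, Real.dist_eq]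
  simp only [NNReal.coe_ofNat]
  linarith

lemma Feasible.ae_differentiableAt (hu : Feasible xA xB yA yC u) :
    ∀ᵐ z ∂((ivol xA xB).prod (ivol yA yC)),
      z ∈ interior (V xA xB yA yC) ∧ DifferentiableAt ℝ u z := by
  have hm : MeasurableSet (V xA xB yA yC) := measurableSet_Icc
  have hfr : ∀ᵐ z ∂(volume : Measure (ℝ × ℝ)), z ∉ frontier (V xA xB yA yC) :=
    measure_eq_zero_iff_ae_notMem.1 ((convex_Icc _ _).addHaar_frontier volume)
  rw [← restrict_V]
  filter_upwards [hu.lipschitzOnWith.ae_differentiableWithinAt (μ := volume) hm,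
    ae_restrict_mem hm, ae_restrict_of_ae hfr] with z h1 h2 h3
  have h4 : z ∈ interior (V xA xB yA yC) := by
    by_contra h
    exact h3 ⟨subset_closure h2, h⟩
  exact ⟨h4, h1.differentiableAt (mem_interior_iff_mem_nhds.1 h4)⟩

lemma Feasible.memLp (hu : Feasible xA xB yA yC u) :
    MemLp u ⊤ ((ivol xA xB).prod (ivol yA yC)) := by
  rw [← restrict_V]
  exact hu.lipschitzOnWith.continuousOn.memLp_top_restrict isCompact_Icc

lemma Feasible.memLp_fderiv_apply (hu : Feasible xA xB yA yC u) (w : ℝ × ℝ) :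
    MemLp (fun z => fderiv ℝ u z w) ⊤ ((ivol xA xB).prod (ivol yA yC)) := by
  refine memLp_top_of_bound (measurable_fderiv_apply_const ℝ u w).aestronglyMeasurable
    (2 * ‖w‖) ?_
  filter_upwards [hu.ae_differentiableAt] with z hz
  refine (ContinuousLinearMap.le_opNorm _ _).trans ?_
  gcongr
  exact norm_fderiv_le_of_lipschitzOn ℝ (mem_interior_iff_mem_nhds.1 hz.1) hu.lipschitzOnWith

lemma Feasible.lipschitzOnWith_snd (hu : Feasible xA xB yA yC u) {x : ℝ} (hx : x ∈ Icc xA xB) :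
    LipschitzOnWith 1 (fun y => u (x, y)) (Icc yA yC) := by
  refine LipschitzOnWith.of_dist_le_mul fun y hy y' hy' => ?_
  simpa [Real.dist_eq] using hu.abs_sub_le hx hx hy hy'

lemma Feasible.lipschitzOnWith_fst (hu : Feasible xA xB yA yC u) {y : ℝ} (hy : y ∈ Icc yA yC) :
    LipschitzOnWith 1 (fun x => u (x, y)) (Icc xA xB) := by
  refine LipschitzOnWith.of_dist_le_mul fun x hx x' hx' => ?_
  simpa [Real.dist_eq] using hu.abs_sub_le hx hx' hy hy

lemma memLp_fst (a b c d : ℝ) :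
    MemLp (fun z : ℝ × ℝ => z.1) ⊤ ((ivol a b).prod (ivol c d)) := by
  rw [← restrict_V]
  exact continuous_fst.continuousOn.memLp_top_restrict isCompact_Icc

lemma memLp_snd (a b c d : ℝ) :
    MemLp (fun z : ℝ × ℝ => z.2) ⊤ ((ivol a b).prod (ivol c d)) := by
  rw [← restrict_V]
  exact continuous_snd.continuousOn.memLp_top_restrict isCompact_Icc

lemma integrable_of_memLp_top {α : Type*} [MeasurableSpace α] {μ : Measure α} [IsFiniteMeasure μ]
    {f : α → ℝ} (hf : MemLp f ⊤ μ) : Integrable f μ := hf.integrable le_top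

variable {f1 f2 : ℝ → ℝ}

lemma Feasible.integral_snd_mul_pd2 (hu : Feasible xA xB yA yC u) (H1 : BoundedPR xA xB f1)
    (H2 : BoundedPR yA yC f2) :
    ∫ z, z.2 * pd2 u z * (f1 z.1 * f2 z.2) ∂((ivol xA xB).prod (ivol yA yC))
      = ∫ x, f1 x * (yC * f2 yC * u (x, yC) - yA * f2 yA * u (x, yA)) ∂(ivol xA xB)
        - ∫ z, u z * (f1 z.1 * mulIdDeriv f2 z.2) ∂((ivol xA xB).prod (ivol yA yC)) := by
  have hI1 : Integrable (fun z : ℝ × ℝ => z.2 * pd2 u z * (f1 z.1 * f2 z.2))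
      ((ivol xA xB).prod (ivol yA yC)) :=
    integrable_of_memLp_top (memLp_top_mul (memLp_top_mul (memLp_snd _ _ _ _)
      (hu.memLp_fderiv_apply (0, 1)))
      (memLp_top_mul (H1.memLp.comp_fst _) (H2.memLp.comp_snd _)))
  have hI2 : Integrable (fun z : ℝ × ℝ => u z * (f1 z.1 * mulIdDeriv f2 z.2))
      ((ivol xA xB).prod (ivol yA yC)) :=
    integrable_of_memLp_top (memLp_top_mul hu.memLp
      (memLp_top_mul (H1.memLp.comp_fst _) (H2.memLp_mulIdDeriv.comp_snd _)))
  have hcont : ∀ y ∈ Icc yA yC, ContinuousOn (fun x => u (x, y)) (Icc xA xB) :=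
    fun y hy => (hu.lipschitzOnWith_fst hy).continuousOn
  have hI3 : Integrable (fun x => f1 x * (yC * f2 yC * u (x, yC) - yA * f2 yA * u (x, yA)))
      (ivol xA xB) := by
    refine integrable_of_memLp_top (ContinuousOn.memLp_top_restrict ?_ isCompact_Icc)
    exact H1.continuousOn.mul ((continuousOn_const.mul (hcont _ (right_mem_Icc.2 H2.lt.le))).sub
      (continuousOn_const.mul (hcont _ (left_mem_Icc.2 H2.lt.le))))
  rw [integral_prod _ hI1, integral_prod _ hI2, ← integral_sub hI3 hI2.integral_prod_left]
  refine integral_congr_ae ?_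
  filter_upwards [Measure.ae_ae_of_ae_prod hu.ae_differentiableAt,
    ae_restrict_mem measurableSet_Icc] with x hx hxm
  have h1 : ∫ y, y * pd2 u (x, y) * (f1 x * f2 y) ∂(ivol yA yC)
      = f1 x * ∫ y, y * f2 y * deriv (fun y => u (x, y)) y ∂(ivol yA yC) := by
    rw [← integral_const_mul]
    refine integral_congr_ae ?_
    filter_upwards [hx] with y hy
    have h2 : HasDerivAt (fun y : ℝ => (x, y)) ((0 : ℝ), (1 : ℝ)) y :=
      (hasDerivAt_const y x).prodMk (hasDerivAt_id y)
    have h3 := (hy.2.hasFDerivAt.comp_hasDerivAt y h2).deriv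
    have h4 : deriv (fun y => u (x, y)) y = pd2 u (x, y) := h3
    simp only [h4]
    ring
  simp only [h1]
  rw [H2.integral_mul_id_mul_deriv (hu.lipschitzOnWith_snd hxm), mul_sub, ← integral_const_mul]
  congr 1
  refine integral_congr_ae (.of_forall fun y => ?_)
  simp only
  ring

end FeasibleFacts

lemma Feasible.swap {xA xB yA yC : ℝ} {u : ℝ × ℝ → ℝ} (hu : Feasible xA xB yA yC u) :
    Feasible yA yC xA xB (u ∘ Prod.swap) := by
  have hV : ∀ z : ℝ × ℝ, z ∈ V yA yC xA xB → z.swap ∈ V xA xB yA yC := by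
    rintro ⟨x, y⟩ hz
    rw [mem_V] at hz
    exact mem_V.2 ⟨hz.2, hz.1⟩
  refine ⟨fun z hz => hu.1 _ (hV z hz), ⟨convex_Icc _ _, ?_⟩, ?_, ?_⟩
  · intro z hz w hw s t hs ht hst
    exact hu.2.1.2 (hV z hz) (hV w hw) hs ht hst
  · intro y y' x h1 h2 h3 hx
    exact hu.2.2.2 x y y' hx h1 h2 h3
  · intro y x x' hy h1 h2 h3
    exact hu.2.2.1 x x' y h1 h2 h3 hy

lemma pd1_comp_swap (u : ℝ × ℝ → ℝ) (z : ℝ × ℝ) : pd1 (u ∘ Prod.swap) z = pd2 u z.swap := by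
  have := (ContinuousLinearEquiv.prodComm ℝ ℝ ℝ).comp_right_fderiv (f := u) (x := z)
  have h2 : u ∘ Prod.swap = u ∘ (ContinuousLinearEquiv.prodComm ℝ ℝ ℝ) := rfl
  rw [pd1, pd2, h2, this]
  rfl

lemma pd2_comp_swap (u : ℝ × ℝ → ℝ) (z : ℝ × ℝ) : pd2 (u ∘ Prod.swap) z = pd1 u z.swap := by
  have := (ContinuousLinearEquiv.prodComm ℝ ℝ ℝ).comp_right_fderiv (f := u) (x := z)
  have h2 : u ∘ Prod.swap = u ∘ (ContinuousLinearEquiv.prodComm ℝ ℝ ℝ) := rfl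
  rw [pd1, pd2, h2, this]
  rfl

lemma Rev_comp_swap (xA xB yA yC : ℝ) (f1 f2 : ℝ → ℝ) (u : ℝ × ℝ → ℝ) :
    Rev yA yC xA xB f2 f1 (u ∘ Prod.swap) = Rev xA xB yA yC f1 f2 u := by
  rw [Rev, Rev, restrict_V, restrict_V, ← integral_prod_swap]
  refine integral_congr_ae (.of_forall fun z => ?_)
  simp only [pd1_comp_swap, pd2_comp_swap, Prod.swap_swap, Prod.fst_swap, Prod.snd_swap,
    Function.comp]
  ring

lemma Feasible.integral_fst_mul_pd1 {xA xB yA yC : ℝ} {u : ℝ × ℝ → ℝ} {f1 f2 : ℝ → ℝ}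
    (hu : Feasible xA xB yA yC u) (H1 : BoundedPR xA xB f1) (H2 : BoundedPR yA yC f2) :
    ∫ z, z.1 * pd1 u z * (f1 z.1 * f2 z.2) ∂((ivol xA xB).prod (ivol yA yC))
      = ∫ y, f2 y * (xB * f1 xB * u (xB, y) - xA * f1 xA * u (xA, y)) ∂(ivol yA yC)
        - ∫ z, u z * (mulIdDeriv f1 z.1 * f2 z.2) ∂((ivol xA xB).prod (ivol yA yC)) := by
  have h := hu.swap.integral_snd_mul_pd2 H2 H1
  rw [← integral_prod_swap, ← integral_prod_swap (fun z : ℝ × ℝ => (u ∘ Prod.swap) z * _)] at h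
  simp only [pd2_comp_swap, Prod.swap_swap, Prod.fst_swap, Prod.snd_swap, Function.comp,
    Prod.swap_prod_mk] at h
  simpa only [mul_comm (f2 _) (f1 _), mul_comm (f2 _) (mulIdDeriv f1 _)] using h

/-- The density with which utility is subtracted in the interior after integrating the revenue
by parts. -/
def weight (f1 f2 : ℝ → ℝ) (z : ℝ × ℝ) : ℝ :=
  f1 z.1 * f2 z.2 + mulIdDeriv f1 z.1 * f2 z.2 + f1 z.1 * mulIdDeriv f2 z.2

section

variable {xA xB yA yC : ℝ} {u v : ℝ × ℝ → ℝ} {f1 f2 : ℝ → ℝ}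

lemma memLp_weight (H1 : BoundedPR xA xB f1) (H2 : BoundedPR yA yC f2) :
    MemLp (weight f1 f2) ⊤ ((ivol xA xB).prod (ivol yA yC)) :=
  ((memLp_top_mul (H1.memLp.comp_fst _) (H2.memLp.comp_snd _)).add
    (memLp_top_mul (H1.memLp_mulIdDeriv.comp_fst _) (H2.memLp.comp_snd _))).add
    (memLp_top_mul (H1.memLp.comp_fst _) (H2.memLp_mulIdDeriv.comp_snd _))

lemma Feasible.integrable_mul_weight (hu : Feasible xA xB yA yC u) (H1 : BoundedPR xA xB f1)
    (H2 : BoundedPR yA yC f2) :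
    Integrable (fun z => u z * weight f1 f2 z) ((ivol xA xB).prod (ivol yA yC)) :=
  integrable_of_memLp_top (memLp_top_mul hu.memLp (memLp_weight H1 H2))

lemma Feasible.integrable_rev (hu : Feasible xA xB yA yC u) (H1 : BoundedPR xA xB f1)
    (H2 : BoundedPR yA yC f2) :
    Integrable (fun z => (z.1 * pd1 u z + z.2 * pd2 u z - u z) * (f1 z.1 * f2 z.2))
      ((ivol xA xB).prod (ivol yA yC)) :=
  integrable_of_memLp_top (memLp_top_mul
    (((memLp_top_mul (memLp_fst _ _ _ _) (hu.memLp_fderiv_apply (1, 0))).add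
      (memLp_top_mul (memLp_snd _ _ _ _) (hu.memLp_fderiv_apply (0, 1)))).sub hu.memLp)
    (memLp_top_mul (H1.memLp.comp_fst _) (H2.memLp.comp_snd _)))

/-- The revenue after integration by parts. -/
lemma Feasible.Rev_eq (hu : Feasible xA xB yA yC u) (H1 : BoundedPR xA xB f1)
    (H2 : BoundedPR yA yC f2) :
    Rev xA xB yA yC f1 f2 u
      = ∫ x, f1 x * (yC * f2 yC * u (x, yC) - yA * f2 yA * u (x, yA)) ∂(ivol xA xB)
        + ∫ y, f2 y * (xB * f1 xB * u (xB, y) - xA * f1 xA * u (xA, y)) ∂(ivol yA yC)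
        - ∫ z, u z * weight f1 f2 z ∂((ivol xA xB).prod (ivol yA yC)) := by
  have hf := memLp_top_mul (H1.memLp.comp_fst (ivol yA yC)) (H2.memLp.comp_snd (ivol xA xB))
  have i1 := integrable_of_memLp_top (memLp_top_mul (memLp_top_mul (memLp_fst xA xB yA yC)
    (hu.memLp_fderiv_apply (1, 0))) hf)
  have i2 := integrable_of_memLp_top (memLp_top_mul (memLp_top_mul (memLp_snd xA xB yA yC)
    (hu.memLp_fderiv_apply (0, 1))) hf)
  have i3 := integrable_of_memLp_top (memLp_top_mul hu.memLp hf)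
  have i4 := integrable_of_memLp_top (memLp_top_mul hu.memLp
    (memLp_top_mul (H1.memLp_mulIdDeriv.comp_fst _) (H2.memLp.comp_snd _)))
  have i5 := integrable_of_memLp_top (memLp_top_mul hu.memLp
    (memLp_top_mul (H1.memLp.comp_fst _) (H2.memLp_mulIdDeriv.comp_snd _)))
  have e1 : Rev xA xB yA yC f1 f2 u
      = ∫ z, z.1 * pd1 u z * (f1 z.1 * f2 z.2) ∂((ivol xA xB).prod (ivol yA yC))
        + ∫ z, z.2 * pd2 u z * (f1 z.1 * f2 z.2) ∂((ivol xA xB).prod (ivol yA yC))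
        - ∫ z, u z * (f1 z.1 * f2 z.2) ∂((ivol xA xB).prod (ivol yA yC)) := by
    rw [Rev, restrict_V]
    simp only [pd1, pd2] at *
    rw [← integral_add i1 i2, ← integral_sub (i1.fun_add i2) i3]
    refine integral_congr_ae (.of_forall fun z => ?_)
    simp only
    ring
  have e2 : ∫ z, u z * weight f1 f2 z ∂((ivol xA xB).prod (ivol yA yC))
      = ∫ z, u z * (f1 z.1 * f2 z.2) ∂((ivol xA xB).prod (ivol yA yC))
        + ∫ z, u z * (mulIdDeriv f1 z.1 * f2 z.2) ∂((ivol xA xB).prod (ivol yA yC))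
        + ∫ z, u z * (f1 z.1 * mulIdDeriv f2 z.2) ∂((ivol xA xB).prod (ivol yA yC)) := by
    rw [← integral_add i3 i4, ← integral_add (i3.fun_add i4) i5]
    refine integral_congr_ae (.of_forall fun z => ?_)
    simp only [weight]
    ring
  rw [e1, e2, hu.integral_fst_mul_pd1 H1 H2, hu.integral_snd_mul_pd2 H1 H2]
  ring

end

section Compare

variable {xA xB yA yC : ℝ} {u v : ℝ × ℝ → ℝ} {f1 f2 : ℝ → ℝ}

lemma weight_nonneg (H1 : BoundedPR xA xB f1) (H2 : BoundedPR yA yC f2)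
    (hC2 : ∀ x ∈ Icc xA xB, ∀ y ∈ Icc yA yC, -3 ≤ PR f1 x + PR f2 y)
    {x y : ℝ} (hx : x ∈ Icc xA xB) (hy : y ∈ Icc yA yC) : 0 ≤ weight f1 f2 (x, y) := by
  have h : weight f1 f2 (x, y) = f1 x * f2 y * (3 + PR f1 x + PR f2 y) := by
    simp only [weight, H1.mulIdDeriv_eq hx, H2.mulIdDeriv_eq hy]
    ring
  rw [h]
  exact mul_nonneg (mul_pos (H1.dens.1 x hx) (H2.dens.1 y hy)).le (by linarith [hC2 x hx y hy])

lemma integral_weight (H2 : BoundedPR yA yC f2) (x : ℝ) :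
    ∫ y, weight f1 f2 (x, y) ∂(ivol yA yC)
      = f1 x + mulIdDeriv f1 x + f1 x * (yC * f2 yC - yA * f2 yA) := by
  have i1 := integrable_of_memLp_top H2.memLp
  have i2 := integrable_of_memLp_top H2.memLp_mulIdDeriv
  simp only [weight]
  rw [integral_add ((i1.const_mul _).fun_add (i1.const_mul _)) (i2.const_mul _),
    integral_add (i1.const_mul _) (i1.const_mul _), integral_const_mul, integral_const_mul,
    integral_const_mul, H2.integral_eq_one, H2.integral_mulIdDeriv]
  ring

lemma Feasible.integrable_edge_snd (hu : Feasible xA xB yA yC u) (H1 : BoundedPR xA xB f1)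
    (hy : yA ≤ yC) (c d : ℝ) :
    Integrable (fun x => f1 x * (c * u (x, yC) - d * u (x, yA))) (ivol xA xB) := by
  refine integrable_of_memLp_top (ContinuousOn.memLp_top_restrict ?_ isCompact_Icc)
  exact H1.continuousOn.mul
    ((continuousOn_const.mul (hu.lipschitzOnWith_fst (right_mem_Icc.2 hy)).continuousOn).sub
    (continuousOn_const.mul (hu.lipschitzOnWith_fst (left_mem_Icc.2 hy)).continuousOn))

lemma Feasible.integrable_edge_fst (hu : Feasible xA xB yA yC u) (H2 : BoundedPR yA yC f2)
    (hx : xA ≤ xB) (c d : ℝ) :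
    Integrable (fun y => f2 y * (c * u (xB, y) - d * u (xA, y))) (ivol yA yC) :=
  hu.swap.integrable_edge_snd H2 hx c d

/-- The revenue difference after integration by parts. -/
lemma Feasible.Rev_sub_Rev (hu : Feasible xA xB yA yC u) (hv : Feasible xA xB yA yC v)
    (H1 : BoundedPR xA xB f1) (H2 : BoundedPR yA yC f2) :
    Rev xA xB yA yC f1 f2 v - Rev xA xB yA yC f1 f2 u
      = ∫ x, f1 x * (yC * f2 yC * (v (x, yC) - u (x, yC))
          - yA * f2 yA * (v (x, yA) - u (x, yA))) ∂(ivol xA xB)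
        + ∫ y, f2 y * (xB * f1 xB * (v (xB, y) - u (xB, y))
          - xA * f1 xA * (v (xA, y) - u (xA, y))) ∂(ivol yA yC)
        - ∫ z, (v z - u z) * weight f1 f2 z ∂((ivol xA xB).prod (ivol yA yC)) := by
  have e1 : ∫ x, f1 x * (yC * f2 yC * (v (x, yC) - u (x, yC))
          - yA * f2 yA * (v (x, yA) - u (x, yA))) ∂(ivol xA xB)
      = ∫ x, f1 x * (yC * f2 yC * v (x, yC) - yA * f2 yA * v (x, yA)) ∂(ivol xA xB)
        - ∫ x, f1 x * (yC * f2 yC * u (x, yC) - yA * f2 yA * u (x, yA)) ∂(ivol xA xB) := by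
    rw [← integral_sub (hv.integrable_edge_snd H1 H2.lt.le _ _)
      (hu.integrable_edge_snd H1 H2.lt.le _ _)]
    refine integral_congr_ae (.of_forall fun x => ?_)
    simp only
    ring
  have e2 : ∫ y, f2 y * (xB * f1 xB * (v (xB, y) - u (xB, y))
          - xA * f1 xA * (v (xA, y) - u (xA, y))) ∂(ivol yA yC)
      = ∫ y, f2 y * (xB * f1 xB * v (xB, y) - xA * f1 xA * v (xA, y)) ∂(ivol yA yC)
        - ∫ y, f2 y * (xB * f1 xB * u (xB, y) - xA * f1 xA * u (xA, y)) ∂(ivol yA yC) := by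
    rw [← integral_sub (hv.integrable_edge_fst H2 H1.lt.le _ _)
      (hu.integrable_edge_fst H2 H1.lt.le _ _)]
    refine integral_congr_ae (.of_forall fun x => ?_)
    simp only
    ring
  have e3 : ∫ z, (v z - u z) * weight f1 f2 z ∂((ivol xA xB).prod (ivol yA yC))
      = ∫ z, v z * weight f1 f2 z ∂((ivol xA xB).prod (ivol yA yC))
        - ∫ z, u z * weight f1 f2 z ∂((ivol xA xB).prod (ivol yA yC)) := by
    rw [← integral_sub (hv.integrable_mul_weight H1 H2) (hu.integrable_mul_weight H1 H2)]
    refine integral_congr_ae (.of_forall fun x => ?_)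
    simp only
    ring
  rw [e1, e2, e3, hu.Rev_eq H1 H2, hv.Rev_eq H1 H2]
  ring

/-- Revenue comparison line by line: if on each vertical line the increment `v - u` is largest at
the top and nonpositive at the bottom, and `v ≥ u` on the right edge, `v ≤ u` on the left edge,
then `v` earns at least as much as `u`. -/
lemma Feasible.Rev_le_Rev (hu : Feasible xA xB yA yC u) (hv : Feasible xA xB yA yC v)
    (hxA : 0 ≤ xA)
    (H1 : BoundedPR xA xB f1) (H2 : BoundedPR yA yC f2)
    (hC2 : ∀ x ∈ Icc xA xB, ∀ y ∈ Icc yA yC, -3 ≤ PR f1 x + PR f2 y)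
    (hC4 : ∀ x ∈ Icc xA xB, -2 ≤ PR f1 x ∧ PR f1 x ≤ yA * f2 yA - 2)
    (hright : ∀ y ∈ Icc yA yC, u (xB, y) ≤ v (xB, y))
    (hleft : ∀ y ∈ Icc yA yC, v (xA, y) ≤ u (xA, y))
    (hbot : ∀ x ∈ Icc xA xB, v (x, yA) ≤ u (x, yA))
    (hline : ∀ x ∈ Icc xA xB, ∀ y ∈ Icc yA yC, v (x, y) - u (x, y) ≤ v (x, yC) - u (x, yC)) :
    Rev xA xB yA yC f1 f2 u ≤ Rev xA xB yA yC f1 f2 v := by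
  have hxm := H1.lt.le
  have hym := H2.lt.le
  have hDm : MemLp (fun x => v (x, yC) - u (x, yC)) ⊤ (ivol xA xB) :=
    ((hv.lipschitzOnWith_fst (right_mem_Icc.2 hym)).continuousOn.sub
      (hu.lipschitzOnWith_fst (right_mem_Icc.2 hym)).continuousOn).memLp_top_restrict isCompact_Icc
  have hI1 : Integrable (fun z : ℝ × ℝ => (v (z.1, yC) - u (z.1, yC)) * weight f1 f2 z)
      ((ivol xA xB).prod (ivol yA yC)) :=
    integrable_of_memLp_top (memLp_top_mul (hDm.comp_fst _) (memLp_weight H1 H2))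
  have hI2 : Integrable (fun z => (v z - u z) * weight f1 f2 z)
      ((ivol xA xB).prod (ivol yA yC)) :=
    integrable_of_memLp_top (memLp_top_mul (hv.memLp.sub hu.memLp) (memLp_weight H1 H2))
  have hI3 : Integrable (fun x => (v (x, yC) - u (x, yC))
      * (f1 x + mulIdDeriv f1 x + f1 x * (yC * f2 yC - yA * f2 yA))) (ivol xA xB) :=
    integrable_of_memLp_top (memLp_top_mul hDm
      ((H1.memLp.add H1.memLp_mulIdDeriv).add (H1.memLp.mul_const _)))
  have hI4 : Integrable (fun x => f1 x * (yC * f2 yC * (v (x, yC) - u (x, yC))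
      - yA * f2 yA * (v (x, yA) - u (x, yA)))) (ivol xA xB) := by
    refine ((hv.integrable_edge_snd H1 hym (yC * f2 yC) (yA * f2 yA)).sub
      (hu.integrable_edge_snd H1 hym (yC * f2 yC) (yA * f2 yA))).congr (.of_forall fun x => ?_)
    simp only [Pi.sub_apply]
    ring
  have h1 : ∫ z, (v z - u z) * weight f1 f2 z ∂((ivol xA xB).prod (ivol yA yC))
      ≤ ∫ x, (v (x, yC) - u (x, yC))
        * (f1 x + mulIdDeriv f1 x + f1 x * (yC * f2 yC - yA * f2 yA)) ∂(ivol xA xB) := by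
    have e : ∫ x, (v (x, yC) - u (x, yC))
        * (f1 x + mulIdDeriv f1 x + f1 x * (yC * f2 yC - yA * f2 yA)) ∂(ivol xA xB)
        = ∫ z : ℝ × ℝ, (v (z.1, yC) - u (z.1, yC)) * weight f1 f2 z
          ∂((ivol xA xB).prod (ivol yA yC)) := by
      rw [integral_prod _ hI1]
      refine integral_congr_ae (.of_forall fun x => ?_)
      simp only
      rw [integral_const_mul, integral_weight H2]
    rw [e]
    refine integral_mono_ae hI2 hI1 ?_
    rw [← restrict_V]
    filter_upwards [ae_restrict_mem (measurableSet_Icc : MeasurableSet (V xA xB yA yC))] with z hz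
    obtain ⟨x, y⟩ := z
    rw [mem_V] at hz
    exact mul_le_mul_of_nonneg_right (hline x hz.1 y hz.2) (weight_nonneg H1 H2 hC2 hz.1 hz.2)
  have h2 : 0 ≤ ∫ y, f2 y * (xB * f1 xB * (v (xB, y) - u (xB, y))
      - xA * f1 xA * (v (xA, y) - u (xA, y))) ∂(ivol yA yC) := by
    refine setIntegral_nonneg measurableSet_Icc fun y hy => ?_
    have a1 := mul_nonneg (mul_nonneg (hxA.trans hxm) (H1.dens.1 _ (right_mem_Icc.2 hxm)).le)
      (sub_nonneg.2 (hright y hy))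
    have a2 := mul_nonneg (mul_nonneg hxA (H1.dens.1 _ (left_mem_Icc.2 hxm)).le)
      (sub_nonneg.2 (hleft y hy))
    exact mul_nonneg (H2.dens.1 y hy).le (by linarith)
  have h3 : ∫ x, (v (x, yC) - u (x, yC))
        * (f1 x + mulIdDeriv f1 x + f1 x * (yC * f2 yC - yA * f2 yA)) ∂(ivol xA xB)
      ≤ ∫ x, f1 x * (yC * f2 yC * (v (x, yC) - u (x, yC))
        - yA * f2 yA * (v (x, yA) - u (x, yA))) ∂(ivol xA xB) := by
    refine setIntegral_mono_on hI3 hI4 measurableSet_Icc fun x hx => ?_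
    rw [H1.mulIdDeriv_eq hx]
    have hb := hbot x hx
    have hl := hline x hx yA (left_mem_Icc.2 hym)
    have hp := hC4 x hx
    have hβ : 0 ≤ yA * f2 yA := by linarith
    generalize v (x, yC) - u (x, yC) = D at *
    generalize hd : v (x, yA) - u (x, yA) = d at *
    have hd0 : d ≤ 0 := by linarith
    have key : 0 ≤ (yA * f2 yA - 2 - PR f1 x) * D - yA * f2 yA * d := by
      rcases le_total 0 D with hD | hD
      · have a1 := mul_nonneg (show 0 ≤ yA * f2 yA - 2 - PR f1 x by linarith) hD
        have a2 := mul_nonneg hβ (neg_nonneg.2 hd0)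
        linarith
      · have a1 := mul_nonneg (show 0 ≤ 2 + PR f1 x by linarith) (neg_nonneg.2 hD)
        have a2 := mul_nonneg hβ (sub_nonneg.2 hl)
        linarith
    have := mul_nonneg (H1.dens.1 x hx).le key
    linarith
  have := hu.Rev_sub_Rev hv H1 H2
  linarith

/-- Revenue is Lipschitz in the utility function for the supremum distance. -/
lemma exists_Rev_lipschitz (hxA : 0 ≤ xA) (hyA : 0 ≤ yA) (H1 : BoundedPR xA xB f1)
    (H2 : BoundedPR yA yC f2) :
    ∃ C, 0 ≤ C ∧ ∀ u v ε, Feasible xA xB yA yC u → Feasible xA xB yA yC v →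
      (∀ z ∈ V xA xB yA yC, |v z - u z| ≤ ε) →
      Rev xA xB yA yC f1 f2 v - Rev xA xB yA yC f1 f2 u ≤ C * ε := by
  have hxm := H1.lt.le
  have hym := H2.lt.le
  have p1 := mul_nonneg (hxA.trans hxm) (H1.dens.1 _ (right_mem_Icc.2 hxm)).le
  have p2 := mul_nonneg hxA (H1.dens.1 _ (left_mem_Icc.2 hxm)).le
  have p3 := mul_nonneg (hyA.trans hym) (H2.dens.1 _ (right_mem_Icc.2 hym)).le
  have p4 := mul_nonneg hyA (H2.dens.1 _ (left_mem_Icc.2 hym)).le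
  have hW : 0 ≤ ∫ z, |weight f1 f2 z| ∂((ivol xA xB).prod (ivol yA yC)) :=
    integral_nonneg fun z => abs_nonneg _
  refine ⟨(yC * f2 yC + yA * f2 yA) + (xB * f1 xB + xA * f1 xA)
    + ∫ z, |weight f1 f2 z| ∂((ivol xA xB).prod (ivol yA yC)), by positivity,
    fun u v ε hu hv h => ?_⟩
  have aux : ∀ {h c d e s t : ℝ}, 0 ≤ h → 0 ≤ c → 0 ≤ d → |s| ≤ e → |t| ≤ e →
      h * (c * s - d * t) ≤ h * ((c + d) * e) := by
    intro h c d e s t hh hc hd hs ht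
    have b1 := mul_le_mul_of_nonneg_left (abs_le.1 hs).2 hc
    have b2 := mul_le_mul_of_nonneg_left (abs_le.1 ht).1 hd
    exact mul_le_mul_of_nonneg_left (by linarith) hh
  have h1 : ∫ x, f1 x * (yC * f2 yC * (v (x, yC) - u (x, yC))
      - yA * f2 yA * (v (x, yA) - u (x, yA))) ∂(ivol xA xB) ≤ (yC * f2 yC + yA * f2 yA) * ε := by
    have e : ∫ x, f1 x * ((yC * f2 yC + yA * f2 yA) * ε) ∂(ivol xA xB)
        = (yC * f2 yC + yA * f2 yA) * ε := by
      rw [integral_mul_const, H1.integral_eq_one, one_mul]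
    rw [← e]
    refine setIntegral_mono_on ?_ ((integrable_of_memLp_top H1.memLp).mul_const _)
      measurableSet_Icc fun x hx => ?_
    · refine ((hv.integrable_edge_snd H1 hym (yC * f2 yC) (yA * f2 yA)).sub
        (hu.integrable_edge_snd H1 hym (yC * f2 yC) (yA * f2 yA))).congr (.of_forall fun x => ?_)
      simp only [Pi.sub_apply]
      ring
    · exact aux (H1.dens.1 x hx).le p3 p4 (h _ (mem_V.2 ⟨hx, right_mem_Icc.2 hym⟩))
        (h _ (mem_V.2 ⟨hx, left_mem_Icc.2 hym⟩))
  have h2 : ∫ y, f2 y * (xB * f1 xB * (v (xB, y) - u (xB, y))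
      - xA * f1 xA * (v (xA, y) - u (xA, y))) ∂(ivol yA yC) ≤ (xB * f1 xB + xA * f1 xA) * ε := by
    have e : ∫ x, f2 x * ((xB * f1 xB + xA * f1 xA) * ε) ∂(ivol yA yC)
        = (xB * f1 xB + xA * f1 xA) * ε := by
      rw [integral_mul_const, H2.integral_eq_one, one_mul]
    rw [← e]
    refine setIntegral_mono_on ?_ ((integrable_of_memLp_top H2.memLp).mul_const _)
      measurableSet_Icc fun x hx => ?_
    · refine ((hv.integrable_edge_fst H2 hxm (xB * f1 xB) (xA * f1 xA)).sub
        (hu.integrable_edge_fst H2 hxm (xB * f1 xB) (xA * f1 xA))).congr (.of_forall fun x => ?_)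
      simp only [Pi.sub_apply]
      ring
    · exact aux (H2.dens.1 x hx).le p1 p2 (h _ (mem_V.2 ⟨right_mem_Icc.2 hxm, hx⟩))
        (h _ (mem_V.2 ⟨left_mem_Icc.2 hxm, hx⟩))
  have h3 : -∫ z, (v z - u z) * weight f1 f2 z ∂((ivol xA xB).prod (ivol yA yC))
      ≤ (∫ z, |weight f1 f2 z| ∂((ivol xA xB).prod (ivol yA yC))) * ε := by
    rw [← integral_neg, ← integral_mul_const]
    refine integral_mono_ae (integrable_of_memLp_top (memLp_top_mul (hv.memLp.sub hu.memLp)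
      (memLp_weight H1 H2))).neg
      ((integrable_of_memLp_top (memLp_weight H1 H2)).abs.mul_const _) ?_
    rw [← restrict_V]
    filter_upwards [ae_restrict_mem (measurableSet_Icc : MeasurableSet (V xA xB yA yC))] with z hz
    calc -((v z - u z) * weight f1 f2 z) ≤ |(v z - u z) * weight f1 f2 z| := neg_le_abs _
      _ = |weight f1 f2 z| * |v z - u z| := by rw [abs_mul, mul_comm]
      _ ≤ _ := mul_le_mul_of_nonneg_left (h z hz) (abs_nonneg _)
  have := hu.Rev_sub_Rev hv H1 H2
  linarith

lemma Feasible.sub_const (hu : Feasible xA xB yA yC u) (hy : yA ≤ yC) {c : ℝ}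
    (hc : c ≤ u (xA, yA)) : Feasible xA xB yA yC (fun z => u z - c) := by
  refine ⟨fun z hz => ?_, hu.2.1.sub (concaveOn_const c (convex_Icc _ _)), ?_, ?_⟩
  · obtain ⟨x, y⟩ := z
    rw [mem_V] at hz
    have h1 := hu.2.2.1 xA x yA le_rfl hz.1.1 hz.1.2 (left_mem_Icc.2 hy)
    have h2 := hu.2.2.2 x yA y hz.1 le_rfl hz.2.1 hz.2.2
    simp only
    linarith
  · intro x x' y h1 h2 h3 h4
    have := hu.2.2.1 x x' y h1 h2 h3 h4
    exact ⟨by linarith, by linarith⟩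
  · intro x y y' h1 h2 h3 h4
    have := hu.2.2.2 x y y' h1 h2 h3 h4
    exact ⟨by linarith, by linarith⟩

lemma Feasible.Rev_le_Rev_sub_const (hu : Feasible xA xB yA yC u) (H1 : BoundedPR xA xB f1)
    (H2 : BoundedPR yA yC f2) {c : ℝ} (hc0 : 0 ≤ c) (hc : c ≤ u (xA, yA)) :
    Rev xA xB yA yC f1 f2 u ≤ Rev xA xB yA yC f1 f2 (fun z => u z - c) := by
  have hi := hu.integrable_rev H1 H2
  have hi' := (hu.sub_const H2.lt.le hc).integrable_rev H1 H2
  rw [Rev, Rev, restrict_V]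
  refine integral_mono_ae hi hi' ?_
  rw [← restrict_V]
  filter_upwards [ae_restrict_mem (measurableSet_Icc : MeasurableSet (V xA xB yA yC))] with z hz
  obtain ⟨x, y⟩ := z
  rw [mem_V] at hz
  refine mul_le_mul_of_nonneg_right ?_ (mul_pos (H1.dens.1 _ hz.1) (H2.dens.1 _ hz.2)).le
  simp only [pd1, pd2, fderiv_sub_const]
  linarith

end Compare

/-- A convex nondecreasing function on `[a,b]` with slopes at most one. -/
structure EdgeFun (a b : ℝ) (T : ℝ → ℝ) : Prop where
  convexOn : ConvexOn ℝ (Icc a b) T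
  mono : ∀ x x', a ≤ x → x ≤ x' → x' ≤ b → T x ≤ T x'
  slope_le : ∀ x x', a ≤ x → x ≤ x' → x' ≤ b → T x' - T x ≤ x' - x

lemma EdgeFun.affine {a b : ℝ} {q : ℝ} (hq : q ∈ Icc (0 : ℝ) 1) (c d : ℝ) :
    EdgeFun a b (fun x => c + q * (x - d)) := by
  refine ⟨⟨convex_Icc _ _, fun x _ y _ s t _ _ hst => ?_⟩, fun x x' _ h _ => ?_,
    fun x x' _ h _ => ?_⟩
  · simp only [smul_eq_mul]
    have : t = 1 - s := by linarith
    subst this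
    exact le_of_eq (by ring)
  · have := mul_le_mul_of_nonneg_left h hq.1
    linarith
  · have := mul_le_mul_of_nonneg_left hq.2 (sub_nonneg.2 h)
    linarith

lemma EdgeFun.continuousOn {a b : ℝ} {T : ℝ → ℝ} (hT : EdgeFun a b T) :
    ContinuousOn T (Icc a b) := by
  refine LipschitzOnWith.continuousOn (K := 1) (LipschitzOnWith.of_le_add fun x hx y hy => ?_)
  rw [Real.dist_eq]
  rcases le_total x y with h | h
  · linarith [hT.mono x y hx.1 h hy.2, abs_nonneg (x - y)]
  · linarith [hT.slope_le y x hy.1 h hx.2, le_abs_self (x - y)]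

/-- The smallest utility with prescribed values `T` on the top edge and `S` on the right edge. -/
def edgeUtility (xB yC : ℝ) (T S : ℝ → ℝ) (z : ℝ × ℝ) : ℝ :=
  max 0 (max (T z.1 - (yC - z.2)) (S z.2 - (xB - z.1)))

lemma edgeUtility_comp_swap (xB yC : ℝ) (T S : ℝ → ℝ) :
    edgeUtility xB yC T S ∘ Prod.swap = edgeUtility yC xB S T := by
  funext z
  simp only [edgeUtility, Function.comp, Prod.fst_swap, Prod.snd_swap]
  rw [max_comm (S z.1 - _)]

lemma max_zero_max_sub_mem {p q r s d : ℝ} (h1 : 0 ≤ r - p) (h2 : r - p ≤ d) (h3 : 0 ≤ s - q)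
    (h4 : s - q ≤ d) :
    0 ≤ max 0 (max r s) - max 0 (max p q) ∧ max 0 (max r s) - max 0 (max p q) ≤ d := by
  constructor
  · exact sub_nonneg.2 (max_le_max le_rfl (max_le_max (by linarith) (by linarith)))
  · have a0 := le_max_left 0 (max p q)
    have a1 := (le_max_left p q).trans (le_max_right 0 (max p q))
    have a2 := (le_max_right p q).trans (le_max_right 0 (max p q))
    rw [sub_le_iff_le_add]
    exact max_le (by linarith) (max_le (by linarith) (by linarith))

section EdgeUtility

variable {xA xB yA yC : ℝ} {T S : ℝ → ℝ} {f1 f2 : ℝ → ℝ}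

lemma feasible_edgeUtility (hT : EdgeFun xA xB T) (hS : EdgeFun yA yC S) :
    Feasible xA xB yA yC (edgeUtility xB yC T S) := by
  have hV : Convex ℝ (V xA xB yA yC) := convex_Icc _ _
  refine ⟨fun z _ => le_max_left _ _, ?_, ?_, ?_⟩
  · have c1 : ConvexOn ℝ (V xA xB yA yC) (fun z => T z.1 - (yC - z.2)) := by
      refine ⟨hV, fun z hz w hw s t hs ht hst => ?_⟩
      obtain ⟨x, y⟩ := z
      obtain ⟨x', y'⟩ := w
      rw [mem_V] at hz hw
      have h := hT.convexOn.2 hz.1 hw.1 hs ht hst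
      simp only [Prod.fst_add, Prod.smul_fst, smul_eq_mul, Prod.snd_add, Prod.smul_snd] at h ⊢
      have : t = 1 - s := by linarith
      subst this
      linarith
    have c2 : ConvexOn ℝ (V xA xB yA yC) (fun z => S z.2 - (xB - z.1)) := by
      refine ⟨hV, fun z hz w hw s t hs ht hst => ?_⟩
      obtain ⟨x, y⟩ := z
      obtain ⟨x', y'⟩ := w
      rw [mem_V] at hz hw
      have h := hS.convexOn.2 hz.2 hw.2 hs ht hst
      simp only [Prod.fst_add, Prod.smul_fst, smul_eq_mul, Prod.snd_add, Prod.smul_snd] at h ⊢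
      have : t = 1 - s := by linarith
      subst this
      linarith
    exact (convexOn_const 0 hV).sup (c1.sup c2)
  · intro x x' y h1 h2 h3 _
    have := hT.mono x x' h1 h2 h3
    have := hT.slope_le x x' h1 h2 h3
    exact max_zero_max_sub_mem (by linarith) (by linarith) (by linarith) (by linarith)
  · intro x y y' _ h1 h2 h3
    have := hS.mono y y' h1 h2 h3
    have := hS.slope_le y y' h1 h2 h3
    exact max_zero_max_sub_mem (by linarith) (by linarith) (by linarith) (by linarith)

/-- Matching edge functions whose utility vanishes at the lower left corner. -/
structure EdgePair (xA xB yA yC : ℝ) (T S : ℝ → ℝ) : Prop where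
  top : EdgeFun xA xB T
  right : EdgeFun yA yC S
  corner : T xB = S yC
  top_nonneg : 0 ≤ T xA
  right_nonneg : 0 ≤ S yA
  top_le : T xA ≤ yC - yA
  right_le : S yA ≤ xB - xA

lemma EdgePair.symm (h : EdgePair xA xB yA yC T S) : EdgePair yA yC xA xB S T :=
  ⟨h.right, h.top, h.corner.symm, h.right_nonneg, h.top_nonneg, h.right_le, h.top_le⟩

lemma Feasible.edgeFun_top {u : ℝ × ℝ → ℝ} (hu : Feasible xA xB yA yC u) (hy : yA ≤ yC) :
    EdgeFun xA xB (fun x => u (x, yC)) := by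
  have hm := right_mem_Icc.2 hy
  refine ⟨⟨convex_Icc _ _, fun x hx x' hx' s t hs ht hst => ?_⟩, fun x x' h1 h2 h3 => ?_,
    fun x x' h1 h2 h3 => ?_⟩
  · have := hu.2.1.2 (mem_V.2 ⟨hx, hm⟩) (mem_V.2 ⟨hx', hm⟩) hs ht hst
    have e : s • (x, yC) + t • (x', yC) = (s • x + t • x', yC) := by
      ext
      · simp
      · simp [← add_mul, hst]
    rwa [e] at this
  · linarith [(hu.2.2.1 x x' yC h1 h2 h3 hm).1]
  · linarith [(hu.2.2.1 x x' yC h1 h2 h3 hm).2]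

lemma Feasible.edgeFun_right {u : ℝ × ℝ → ℝ} (hu : Feasible xA xB yA yC u) (hx : xA ≤ xB) :
    EdgeFun yA yC (fun y => u (xB, y)) :=
  hu.swap.edgeFun_top hx

lemma Feasible.edgePair {u : ℝ × ℝ → ℝ} (hu : Feasible xA xB yA yC u) (hx : xA ≤ xB)
    (hy : yA ≤ yC) (h0 : u (xA, yA) = 0) :
    EdgePair xA xB yA yC (fun x => u (x, yC)) (fun y => u (xB, y)) := by
  have mx := left_mem_Icc.2 hx
  have my := left_mem_Icc.2 hy
  have h1 := hu.2.2.1 xA xB yA le_rfl hx le_rfl my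
  have h2 := hu.2.2.2 xA yA yC mx le_rfl hy le_rfl
  exact ⟨hu.edgeFun_top hy, hu.edgeFun_right hx, rfl, by linarith, by linarith, by linarith,
    by linarith⟩

/-- Lowering a utility to the smallest one with the same values on the top and right edges does
not decrease revenue. -/
lemma Feasible.Rev_le_Rev_edgeUtility {u : ℝ × ℝ → ℝ} (hu : Feasible xA xB yA yC u)
    (hxA : 0 ≤ xA) (H1 : BoundedPR xA xB f1) (H2 : BoundedPR yA yC f2)
    (hC2 : ∀ x ∈ Icc xA xB, ∀ y ∈ Icc yA yC, -3 ≤ PR f1 x + PR f2 y)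
    (hC4 : ∀ x ∈ Icc xA xB, -2 ≤ PR f1 x ∧ PR f1 x ≤ yA * f2 yA - 2) :
    Rev xA xB yA yC f1 f2 u
      ≤ Rev xA xB yA yC f1 f2 (edgeUtility xB yC (fun x => u (x, yC)) (fun y => u (xB, y))) := by
  have hx := H1.lt.le
  have hy := H2.lt.le
  have hle : ∀ x ∈ Icc xA xB, ∀ y ∈ Icc yA yC,
      edgeUtility xB yC (fun x => u (x, yC)) (fun y => u (xB, y)) (x, y) ≤ u (x, y) := by
    intro x hxm y hym
    refine max_le (hu.1 _ (mem_V.2 ⟨hxm, hym⟩)) (max_le ?_ ?_)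
    · linarith [(hu.2.2.2 x y yC hxm hym.1 hym.2 le_rfl).2]
    · linarith [(hu.2.2.1 x xB y hxm.1 hxm.2 le_rfl hym).2]
  have htop : ∀ x, u (x, yC)
      ≤ edgeUtility xB yC (fun x => u (x, yC)) (fun y => u (xB, y)) (x, yC) := by
    intro x
    refine le_max_of_le_right (le_max_of_le_left ?_)
    simp
  refine hu.Rev_le_Rev (feasible_edgeUtility (hu.edgeFun_top hy) (hu.edgeFun_right hx)) hxA H1 H2
    hC2 hC4 (fun y _ => ?_) (fun y hym => hle _ (left_mem_Icc.2 hx) _ hym)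
    (fun x hxm => hle _ hxm _ (left_mem_Icc.2 hy)) (fun x hxm y hym => ?_)
  · refine le_max_of_le_right (le_max_of_le_right ?_)
    simp
  · linarith [hle x hxm y hym, htop x]

lemma EdgePair.edgeUtility_top (h : EdgePair xA xB yA yC T S) {x : ℝ} (hx : x ∈ Icc xA xB) :
    edgeUtility xB yC T S (x, yC) = T x := by
  have h1 := h.top_nonneg
  have h2 := h.top.mono xA x le_rfl hx.1 hx.2
  have h3 := h.top.slope_le x xB hx.1 hx.2 le_rfl
  have h4 := h.corner
  simp only [edgeUtility]
  rw [max_eq_left (a := T x - _) (by linarith), max_eq_right (by linarith)]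
  ring

/-- The chord of `T` over `[a,b]`. -/
def chord (a b : ℝ) (T : ℝ → ℝ) (x : ℝ) : ℝ := T a + (T b - T a) / (b - a) * (x - a)

lemma EdgeFun.chord_slope_mem (hT : EdgeFun xA xB T) (hx : xA ≤ xB) :
    (T xB - T xA) / (xB - xA) ∈ Icc (0 : ℝ) 1 := by
  have h1 := hT.mono xA xB le_rfl hx le_rfl
  have h2 := hT.slope_le xA xB le_rfl hx le_rfl
  exact ⟨div_nonneg (by linarith) (by linarith), div_le_one_of_le₀ h2 (by linarith)⟩

lemma chord_left (a b : ℝ) (T : ℝ → ℝ) : chord a b T a = T a := by simp [chord]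

lemma chord_right {a b : ℝ} (h : a < b) (T : ℝ → ℝ) : chord a b T b = T b := by
  have : b - a ≠ 0 := by linarith
  rw [chord]
  field_simp
  ring

lemma EdgeFun.edgeFun_chord (hT : EdgeFun xA xB T) (hx : xA ≤ xB) :
    EdgeFun xA xB (chord xA xB T) :=
  EdgeFun.affine (hT.chord_slope_mem hx) _ _

lemma ConvexOn.le_chord {s : Set ℝ} (hT : ConvexOn ℝ s T) {a b x : ℝ} (ha : a ∈ s) (hb : b ∈ s)
    (hx : x ∈ Icc a b) : T x ≤ chord a b T x := by
  rcases hx.1.eq_or_lt with rfl | h1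
  · exact (chord_left _ _ _).ge
  have hab : 0 < b - a := by linarith [hx.2]
  have h := hT.2 ha hb (div_nonneg (by linarith [hx.2]) hab.le : 0 ≤ (b - x) / (b - a))
    (div_nonneg (by linarith) hab.le : 0 ≤ (x - a) / (b - a)) (by field_simp; ring)
  have e : ((b - x) / (b - a)) • a + ((x - a) / (b - a)) • b = x := by
    simp only [smul_eq_mul]
    field_simp
    ring
  rw [e] at h
  refine h.trans (le_of_eq ?_)
  simp only [smul_eq_mul, chord]
  field_simp
  ring

lemma ConvexOn.chord_le {s : Set ℝ} (hT : ConvexOn ℝ s T) {a b x : ℝ} (ha : a ∈ s) (hx : x ∈ s)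
    (hab : a < b) (hbx : b ≤ x) : chord a b T x ≤ T x := by
  rcases hbx.eq_or_lt with rfl | h
  · exact (chord_right hab _).le
  have h1 := hT.slope_mono_adjacent ha hx hab h
  have h2 := (le_div_iff₀ (by linarith : 0 < x - b)).1 h1
  have e : chord a b T x = T b + (T b - T a) / (b - a) * (x - b) := by
    have : b - a ≠ 0 := by linarith
    rw [chord]
    field_simp
    ring
  rw [e]
  linarith

/-- If the chord of `T` stays below the level at which the bottom edge is reached, replacing `T` by
its chord does not decrease revenue. -/
lemma EdgePair.Rev_le_chord (h : EdgePair xA xB yA yC T S) (hxA : 0 ≤ xA)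
    (H1 : BoundedPR xA xB f1) (H2 : BoundedPR yA yC f2)
    (hC2 : ∀ x ∈ Icc xA xB, ∀ y ∈ Icc yA yC, -3 ≤ PR f1 x + PR f2 y)
    (hC4 : ∀ x ∈ Icc xA xB, -2 ≤ PR f1 x ∧ PR f1 x ≤ yA * f2 yA - 2)
    (hc : chord xA xB T (xB - S yA) ≤ yC - yA) :
    EdgePair xA xB yA yC (chord xA xB T) S ∧
    Rev xA xB yA yC f1 f2 (edgeUtility xB yC T S)
      ≤ Rev xA xB yA yC f1 f2 (edgeUtility xB yC (chord xA xB T) S) := by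
  have hx := H1.lt.le
  have hT' := h.top.edgeFun_chord hx
  have hl := chord_left xA xB T
  have hr := chord_right H1.lt T
  have hp : EdgePair xA xB yA yC (chord xA xB T) S :=
    ⟨hT', h.right, hr.trans h.corner, hl ▸ h.top_nonneg, h.right_nonneg, hl ▸ h.top_le,
      h.right_le⟩
  have hle : ∀ x ∈ Icc xA xB, T x ≤ chord xA xB T x := fun x hxm =>
    h.top.convexOn.le_chord (left_mem_Icc.2 hx) (right_mem_Icc.2 hx) hxm
  have h1 := h.right_le
  have h2 := h.right_nonneg
  refine ⟨hp, (feasible_edgeUtility h.top h.right).Rev_le_Rev (feasible_edgeUtility hT' h.right)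
    hxA H1 H2 hC2 hC4 (fun y _ => ?_) (fun y _ => ?_) (fun x hxm => ?_) (fun x hxm y hym => ?_)⟩
  · simp only [edgeUtility, hr]; exact le_rfl
  · simp only [edgeUtility, hl]; exact le_rfl
  · simp only [edgeUtility]
    refine max_le (le_max_left _ _) (max_le ?_ (le_max_of_le_right (le_max_right _ _)))
    rcases le_total x (xB - S yA) with hxs | hxs
    · have := hT'.mono x (xB - S yA) hxm.1 hxs (by linarith)
      exact le_max_of_le_left (by linarith)
    · have := hT'.slope_le (xB - S yA) x (by linarith) hxs hxm.2
      exact le_max_of_le_right (le_max_of_le_right (by linarith))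
  · rw [hp.edgeUtility_top hxm, h.edgeUtility_top hxm]
    have := hle x hxm
    exact (max_zero_max_sub_mem (by linarith) (by linarith) (by linarith) (by linarith)).2

/-- If the chord of `T` exceeds the level at which the bottom edge is reached, an affine top branch
together with the bundle does at least as well. -/
lemma EdgePair.exists_Rev_le_bundle (h : EdgePair xA xB yA yC T S) (hxA : 0 ≤ xA)
    (H1 : BoundedPR xA xB f1) (H2 : BoundedPR yA yC f2)
    (hC2 : ∀ x ∈ Icc xA xB, ∀ y ∈ Icc yA yC, -3 ≤ PR f1 x + PR f2 y)
    (hC4 : ∀ x ∈ Icc xA xB, -2 ≤ PR f1 x ∧ PR f1 x ≤ yA * f2 yA - 2)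
    (hc : yC - yA < chord xA xB T (xB - S yA)) :
    ∃ q ∈ Icc (0 : ℝ) 1, ∃ c ∈ Icc xA xB, Rev xA xB yA yC f1 f2 (edgeUtility xB yC T S)
      ≤ Rev xA xB yA yC f1 f2 (edgeUtility xB yC (fun x => yC - yA + q * (x - c))
        (fun y => S yA + 1 * (y - yA))) := by
  have hx := H1.lt.le
  have hT' := h.top.edgeFun_chord hx
  have h1 := h.right_le
  have h2 := h.right_nonneg
  have h3 := h.top_le
  have hl := chord_left xA xB T
  have hs := hT'.slope_le xA (xB - S yA) le_rfl (by linarith) (by linarith)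
  rw [hl] at hs
  obtain ⟨q, hq, c, hcm, hcs, hcl, hbelow, hcT⟩ : ∃ q ∈ Icc (0 : ℝ) 1, ∃ c ∈ Icc xA xB,
      c ≤ xB - S yA ∧ yC - yA + q * (xA - c) = T xA ∧
      (∀ x ∈ Icc xA c, T x ≤ yC - yA + q * (x - c)) ∧
      ∀ x ∈ Icc c xB, yC - yA + q * (x - c) ≤ max (T x) (S yA + (yC - yA) - (xB - x)) := by
    have hsm : xB - S yA ∈ Icc xA xB := ⟨by linarith, by linarith⟩
    rcases le_total (T (xB - S yA)) (yC - yA) with hle | hge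
    · have hlt : xA < xB - S yA := by linarith
      have hne : xB - S yA - xA ≠ 0 := by linarith
      have hq1 : (yC - yA - T xA) / (xB - S yA - xA) ≤ 1 :=
        div_le_one_of_le₀ (by linarith) (by linarith)
      refine ⟨(yC - yA - T xA) / (xB - S yA - xA),
        ⟨div_nonneg (by linarith) (by linarith), hq1⟩, xB - S yA, hsm, le_rfl, ?_, ?_, ?_⟩
      · field_simp
        ring
      · intro x hxm
        have h4 := h.top.convexOn.le_chord (left_mem_Icc.2 hx) hsm hxm
        have h5 : chord xA (xB - S yA) T x = T (xB - S yA)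
            + (T (xB - S yA) - T xA) / (xB - S yA - xA) * (x - (xB - S yA)) := by
          rw [chord]
          field_simp
          ring
        have h7 : 0 ≤ (x - xA) / (xB - S yA - xA) :=
          div_nonneg (by linarith [hxm.1]) (by linarith)
        have h8 : yC - yA + (yC - yA - T xA) / (xB - S yA - xA) * (x - (xB - S yA))
            - chord xA (xB - S yA) T x
            = (yC - yA - T (xB - S yA)) * ((x - xA) / (xB - S yA - xA)) := by
          rw [h5]
          field_simp
          ring
        have := mul_nonneg (sub_nonneg.2 hle) h7
        linarith
      · intro x hxm
        refine le_max_of_le_right ?_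
        have := mul_le_mul_of_nonneg_right hq1 (sub_nonneg.2 hxm.1)
        linarith
    · obtain ⟨c, hc, hTc⟩ := intermediate_value_Icc hsm.1
        (h.top.continuousOn.mono (Icc_subset_Icc_right hsm.2)) ⟨h3, hge⟩
      have hcm : c ∈ Icc xA xB := ⟨hc.1, hc.2.trans hsm.2⟩
      rcases hc.1.eq_or_lt with rfl | hlt
      · refine ⟨0, ⟨le_rfl, zero_le_one⟩, xA, hcm, hc.2, by linarith, ?_, ?_⟩
        · intro x hxm
          have := le_antisymm hxm.1 hxm.2
          subst this
          linarith
        · intro x hxm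
          refine le_max_of_le_left ?_
          linarith [h.top.mono xA x le_rfl hxm.1 hxm.2]
      · have hne : c - xA ≠ 0 := by linarith
        have e : ∀ x, yC - yA + (T c - T xA) / (c - xA) * (x - c) = chord xA c T x := by
          intro x
          rw [← hTc, chord]
          field_simp
          ring
        have a1 := h.top.mono xA c le_rfl hc.1 hcm.2
        have a2 := h.top.slope_le xA c le_rfl hc.1 hcm.2
        refine ⟨(T c - T xA) / (c - xA), ⟨div_nonneg (by linarith) (by linarith),
          div_le_one_of_le₀ a2 (by linarith)⟩, c, hcm, hc.2, ?_, ?_, ?_⟩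
        · rw [e, chord_left]
        · intro x hxm
          rw [e]
          exact h.top.convexOn.le_chord (left_mem_Icc.2 hx) hcm hxm
        · intro x hxm
          rw [e]
          exact le_max_of_le_left (h.top.convexOn.chord_le (left_mem_Icc.2 hx)
            ⟨hc.1.trans hxm.1, hxm.2⟩ hlt hxm.1)
  refine ⟨q, hq, c, hcm, ?_⟩
  have hfu := feasible_edgeUtility h.top h.right
  refine hfu.Rev_le_Rev (feasible_edgeUtility
    (EdgeFun.affine hq _ _) (EdgeFun.affine ⟨zero_le_one, le_rfl⟩ _ _))
    hxA H1 H2 hC2 hC4 (fun y hym => ?_) (fun y hym => ?_) (fun x hxm => ?_)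
    (fun x hxm y hym => ?_)
  · have a1 := h.right.slope_le y yC hym.1 hym.2 le_rfl
    have a2 := h.right.slope_le yA y le_rfl hym.1 hym.2
    have a3 := h.corner
    simp only [edgeUtility]
    refine (max_le ?_ (max_le ?_ ?_)).trans ((le_max_right _ _).trans (le_max_right _ _))
    · linarith [hym.1]
    · linarith
    · linarith
  · simp only [edgeUtility, hcl]
    refine max_le (le_max_left _ _) (max_le (le_max_of_le_right (le_max_left _ _)) ?_)
    exact le_max_of_le_right (le_max_of_le_left (by linarith))
  · simp only [edgeUtility]
    refine max_le (le_max_left _ _) (max_le ?_ (le_max_of_le_right (le_max_of_le_right ?_)))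
    · rcases le_total x c with hxc | hxc
      · have := mul_nonneg hq.1 (sub_nonneg.2 hxc)
        exact le_max_of_le_left (by linarith)
      · rcases le_max_iff.1 (hcT x ⟨hxc, hxm.2⟩) with h4 | h4
        · exact le_max_of_le_right (le_max_of_le_left (by linarith))
        · exact le_max_of_le_right (le_max_of_le_right (by linarith))
    · linarith
  · rw [h.edgeUtility_top hxm]
    have hmono := hfu.2.2.2 x y yC hxm hym.1 hym.2 le_rfl
    rw [h.edgeUtility_top hxm] at hmono
    have hnn := hfu.1 (x, y) (mem_V.2 ⟨hxm, hym⟩)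
    have b1 : yC - yA + q * (x - c)
        ≤ edgeUtility xB yC (fun x => yC - yA + q * (x - c)) (fun y => S yA + 1 * (y - yA))
          (x, yC) := le_max_of_le_right (le_max_of_le_left (by simp))
    have b2 : S yA + (yC - yA) - (xB - x)
        ≤ edgeUtility xB yC (fun x => yC - yA + q * (x - c)) (fun y => S yA + 1 * (y - yA))
          (x, yC) := le_max_of_le_right (le_max_of_le_right (by simp))
    have b3 : (0 : ℝ)
        ≤ edgeUtility xB yC (fun x => yC - yA + q * (x - c)) (fun y => S yA + 1 * (y - yA))
          (x, yC) := le_max_left _ _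
    generalize edgeUtility xB yC (fun x => yC - yA + q * (x - c)) (fun y => S yA + 1 * (y - yA))
          (x, yC) = vt at *
    rw [sub_le_iff_le_add]
    refine max_le ?_ (max_le ?_ ?_)
    · rcases le_total x c with hxc | hxc
      · linarith [hbelow x ⟨hxm.1, hxc⟩]
      · have := mul_nonneg hq.1 (sub_nonneg.2 hxc)
        linarith [hym.1]
    · simp only
      linarith
    · simp only
      linarith

end EdgeUtility

/-- The utility of a buyer facing the options `((q, 1), t)` and `((1, q'), t')`, where
`p = (q, t, q', t')`. -/
def menu (p : ℝ × ℝ × ℝ × ℝ) (z : ℝ × ℝ) : ℝ :=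
  max 0 (max (p.1 * z.1 + z.2 - p.2.1) (z.1 + p.2.2.1 * z.2 - p.2.2.2))

/-- The allocations and prices that suffice for valuations up to `(xB, yC)`. -/
def menuBox (xB yC : ℝ) : Set (ℝ × ℝ × ℝ × ℝ) :=
  Icc (0, 0, 0, 0) (1, xB + yC, 1, xB + yC)

lemma mem_menuBox {xB yC q t q' t' : ℝ} : (q, t, q', t') ∈ menuBox xB yC ↔
    q ∈ Icc (0 : ℝ) 1 ∧ t ∈ Icc 0 (xB + yC) ∧ q' ∈ Icc (0 : ℝ) 1 ∧ t' ∈ Icc 0 (xB + yC) := by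
  simp only [menuBox, mem_Icc, Prod.mk_le_mk]
  tauto

lemma edgeUtility_affine (xB yC c q d c' q' d' : ℝ) :
    edgeUtility xB yC (fun x => c + q * (x - d)) (fun y => c' + q' * (y - d'))
      = menu (q, yC - c + q * d, q', xB - c' + q' * d') := by
  funext z
  simp only [edgeUtility, menu]
  congr 2 <;> ring

section Menu

variable {xA xB yA yC : ℝ} {f1 f2 : ℝ → ℝ}

lemma feasible_menu {p : ℝ × ℝ × ℝ × ℝ} (hp : p ∈ menuBox xB yC) :
    Feasible xA xB yA yC (menu p) := by
  obtain ⟨q, t, q', t'⟩ := p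
  rw [mem_menuBox] at hp
  have h := feasible_edgeUtility (xA := xA) (xB := xB) (yA := yA) (yC := yC)
    (EdgeFun.affine hp.1 (yC - t) 0) (EdgeFun.affine hp.2.2.1 (xB - t') 0)
  rw [edgeUtility_affine] at h
  simpa using h

/-- Every edge utility is dominated by a menu with at most two nonzero options. -/
lemma EdgePair.exists_Rev_le_menu {T S : ℝ → ℝ} (h : EdgePair xA xB yA yC T S) (hxA : 0 ≤ xA)
    (hyA : 0 ≤ yA) (H1 : BoundedPR xA xB f1) (H2 : BoundedPR yA yC f2)
    (hC2 : ∀ x ∈ Icc xA xB, ∀ y ∈ Icc yA yC, -3 ≤ PR f1 x + PR f2 y)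
    (hC4a : ∀ x ∈ Icc xA xB, -2 ≤ PR f1 x ∧ PR f1 x ≤ yA * f2 yA - 2)
    (hC4b : ∀ y ∈ Icc yA yC, -2 ≤ PR f2 y ∧ PR f2 y ≤ xA * f1 xA - 2) :
    ∃ p ∈ menuBox xB yC,
      Rev xA xB yA yC f1 f2 (edgeUtility xB yC T S) ≤ Rev xA xB yA yC f1 f2 (menu p) := by
  have hC2' : ∀ y ∈ Icc yA yC, ∀ x ∈ Icc xA xB, -3 ≤ PR f2 y + PR f1 x := fun y hy x hx => by
    rw [add_comm]; exact hC2 x hx y hy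
  have hx := H1.lt
  have hy := H2.lt
  have e1 := h.top_nonneg
  have e2 := h.top_le
  have e3 := h.right_nonneg
  have e4 := h.right_le
  rcases lt_or_ge (yC - yA) (chord xA xB T (xB - S yA)) with hc | hc
  · obtain ⟨q, hq, c, hcm, hle⟩ := h.exists_Rev_le_bundle hxA H1 H2 hC2 hC4a hc
    rw [edgeUtility_affine] at hle
    have b1 := mul_nonneg hq.1 (hxA.trans hcm.1)
    have b2 := mul_le_of_le_one_left (hxA.trans hcm.1) hq.2
    have b3 := hcm.2
    exact ⟨_, mem_menuBox.2 ⟨hq, ⟨by linarith, by linarith⟩, ⟨zero_le_one, le_rfl⟩,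
      ⟨by linarith, by linarith⟩⟩, hle⟩
  · obtain ⟨h', hle⟩ := h.Rev_le_chord hxA H1 H2 hC2 hC4a hc
    rw [← Rev_comp_swap xA xB yA yC f1 f2 (edgeUtility xB yC (chord xA xB T) S),
      edgeUtility_comp_swap] at hle
    rcases lt_or_ge (xB - xA) (chord yA yC S (yC - chord xA xB T xA)) with hd | hd
    · obtain ⟨q, hq, c, hcm, hle'⟩ := h'.symm.exists_Rev_le_bundle hyA H2 H1 hC2' hC4b hd
      have hle2 := hle.trans hle'
      rw [← Rev_comp_swap yA yC xA xB, edgeUtility_comp_swap, edgeUtility_affine, chord_left]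
        at hle2
      have b1 := mul_nonneg hq.1 (hyA.trans hcm.1)
      have b2 := mul_le_of_le_one_left (hyA.trans hcm.1) hq.2
      have b3 := hcm.2
      exact ⟨_, mem_menuBox.2 ⟨⟨zero_le_one, le_rfl⟩, ⟨by linarith, by linarith⟩, hq,
        ⟨by linarith, by linarith⟩⟩, hle2⟩
    · have hle2 := hle.trans (h'.symm.Rev_le_chord hyA H2 H1 hC2' hC4b hd).2
      rw [← Rev_comp_swap yA yC xA xB, edgeUtility_comp_swap] at hle2
      have hq := h.top.chord_slope_mem hx.le
      have hq' := h.right.chord_slope_mem hy.le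
      have b1 := mul_nonneg hq.1 hxA
      have b2 := mul_le_of_le_one_left hxA hq.2
      have b3 := mul_nonneg hq'.1 hyA
      have b4 := mul_le_of_le_one_left hyA hq'.2
      exact ⟨_, mem_menuBox.2 ⟨hq, ⟨by linarith, by linarith⟩, hq', ⟨by linarith, by linarith⟩⟩,
        hle2.trans_eq (congrArg _ (edgeUtility_affine _ _ _ _ _ _ _ _))⟩

lemma Feasible.exists_Rev_le_menu {u : ℝ × ℝ → ℝ} (hu : Feasible xA xB yA yC u) (hxA : 0 ≤ xA)
    (hyA : 0 ≤ yA) (H1 : BoundedPR xA xB f1) (H2 : BoundedPR yA yC f2)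
    (hC2 : ∀ x ∈ Icc xA xB, ∀ y ∈ Icc yA yC, -3 ≤ PR f1 x + PR f2 y)
    (hC4a : ∀ x ∈ Icc xA xB, -2 ≤ PR f1 x ∧ PR f1 x ≤ yA * f2 yA - 2)
    (hC4b : ∀ y ∈ Icc yA yC, -2 ≤ PR f2 y ∧ PR f2 y ≤ xA * f1 xA - 2) :
    ∃ p ∈ menuBox xB yC, Rev xA xB yA yC f1 f2 u ≤ Rev xA xB yA yC f1 f2 (menu p) := by
  have hx := H1.lt.le
  have hy := H2.lt.le
  have hc0 := hu.1 _ (mem_V.2 ⟨left_mem_Icc.2 hx, left_mem_Icc.2 hy⟩)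
  have hv := hu.sub_const hy (le_refl (u (xA, yA)))
  obtain ⟨p, hp, hle⟩ := (hv.edgePair hx hy (sub_self _)).exists_Rev_le_menu hxA hyA H1 H2
    hC2 hC4a hC4b
  exact ⟨p, hp, ((hu.Rev_le_Rev_sub_const H1 H2 hc0 le_rfl).trans
    (hv.Rev_le_Rev_edgeUtility hxA H1 H2 hC2 hC4a)).trans hle⟩

lemma abs_menu_sub_menu_le (hxA : 0 ≤ xA) (hyA : 0 ≤ yA) (p p' : ℝ × ℝ × ℝ × ℝ) {z : ℝ × ℝ}
    (hz : z ∈ V xA xB yA yC) : |menu p z - menu p' z| ≤ (xB + yC + 1) * dist p p' := by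
  obtain ⟨q, t, r, s⟩ := p
  obtain ⟨q', t', r', s'⟩ := p'
  obtain ⟨x, y⟩ := z
  rw [mem_V] at hz
  obtain ⟨⟨hx1, hx2⟩, hy1, hy2⟩ := hz
  simp only [menu, Prod.dist_eq, Real.dist_eq]
  generalize hd : max |q - q'| (max |t - t'| (max |r - r'| |s - s'|)) = d
  have d1 : |q - q'| ≤ d := hd ▸ le_max_left _ _
  have d2 : |t - t'| ≤ d := hd ▸ (le_max_left _ _).trans (le_max_right _ _)
  have d3 : |r - r'| ≤ d :=
    hd ▸ (le_max_left _ _).trans ((le_max_right _ _).trans (le_max_right _ _))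
  have d4 : |s - s'| ≤ d :=
    hd ▸ (le_max_right _ _).trans ((le_max_right _ _).trans (le_max_right _ _))
  have d0 : 0 ≤ d := (abs_nonneg _).trans d1
  have m1 : |(q - q') * x| ≤ d * xB := by
    rw [abs_mul, abs_of_nonneg (hxA.trans hx1)]
    exact mul_le_mul d1 hx2 (hxA.trans hx1) d0
  have m2 : |(r - r') * y| ≤ d * yC := by
    rw [abs_mul, abs_of_nonneg (hyA.trans hy1)]
    exact mul_le_mul d3 hy2 (hyA.trans hy1) d0
  have n1 : 0 ≤ d * xB := (abs_nonneg _).trans m1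
  have n2 : 0 ≤ d * yC := (abs_nonneg _).trans m2
  have k1 : |(q * x + y - t) - (q' * x + y - t')| ≤ (xB + yC + 1) * d := by
    rw [show (q * x + y - t) - (q' * x + y - t') = (q - q') * x - (t - t') by ring]
    exact (abs_sub _ _).trans (by linarith)
  have k2 : |(x + r * y - s) - (x + r' * y - s')| ≤ (xB + yC + 1) * d := by
    rw [show (x + r * y - s) - (x + r' * y - s') = (r - r') * y - (s - s') by ring]
    exact (abs_sub _ _).trans (by linarith)
  refine (abs_max_sub_max_le_max _ _ _ _).trans (max_le ?_
    ((abs_max_sub_max_le_max _ _ _ _).trans (max_le k1 k2)))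
  rw [sub_self, abs_zero]
  linarith

lemma continuousOn_Rev_menu (hxA : 0 ≤ xA) (hyA : 0 ≤ yA) (H1 : BoundedPR xA xB f1)
    (H2 : BoundedPR yA yC f2) :
    ContinuousOn (fun p => Rev xA xB yA yC f1 f2 (menu p)) (menuBox xB yC) := by
  obtain ⟨C, hC0, hC⟩ := exists_Rev_lipschitz hxA hyA H1 H2
  have hK : 0 ≤ C * (xB + yC + 1) :=
    mul_nonneg hC0 (by linarith [H1.lt, H2.lt])
  refine (LipschitzOnWith.of_le_add_mul (NNReal.mk _ hK) fun p hp p' hp' => ?_).continuousOn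
  have := hC (menu p') (menu p) _ (feasible_menu hp') (feasible_menu hp)
    fun z hz => abs_menu_sub_menu_le hxA hyA p p' hz
  rw [NNReal.coe_mk, mul_assoc]
  linarith

/-- The payment at a point of differentiability is the price of the chosen option. -/
lemma payment_eq_of_active {u : ℝ × ℝ → ℝ} {z : ℝ × ℝ} {q q' t : ℝ} (hd : DifferentiableAt ℝ u z)
    (hle : ∀ w : ℝ × ℝ, q * w.1 + q' * w.2 - t ≤ u w) (hz : u z = q * z.1 + q' * z.2 - t) :
    z.1 * pd1 u z + z.2 * pd2 u z - u z = t := by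
  have h1 : HasFDerivAt (fun w : ℝ × ℝ => q * w.1 + q' * w.2 - t)
      (q • ContinuousLinearMap.fst ℝ ℝ ℝ + q' • ContinuousLinearMap.snd ℝ ℝ ℝ) z :=
    ((hasFDerivAt_fst.const_mul q).add (hasFDerivAt_snd.const_mul q')).sub_const t
  have hmin : IsLocalMin (fun w => u w - (q * w.1 + q' * w.2 - t)) z :=
    .of_forall fun w => by
      simp only [hz, sub_self]
      exact sub_nonneg.2 (hle w)
  have h2 := sub_eq_zero.1 (hmin.hasFDerivAt_eq_zero (hd.hasFDerivAt.sub h1))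
  simp only [pd1, pd2, h2, hz]
  simp
  ring

lemma setIntegral_density (H1 : BoundedPR xA xB f1) (H2 : BoundedPR yA yC f2) :
    ∫ z in V xA xB yA yC, f1 z.1 * f2 z.2 = 1 := by
  rw [restrict_V, integral_prod_mul f1 f2, H1.integral_eq_one, H2.integral_eq_one, one_mul]

lemma integrableOn_density (H1 : BoundedPR xA xB f1) (H2 : BoundedPR yA yC f2) :
    IntegrableOn (fun z : ℝ × ℝ => f1 z.1 * f2 z.2) (V xA xB yA yC) := by
  rw [IntegrableOn, restrict_V]
  exact integrable_of_memLp_top (memLp_top_mul (H1.memLp.comp_fst _) (H2.memLp.comp_snd _))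

lemma density_nonneg (H1 : BoundedPR xA xB f1) (H2 : BoundedPR yA yC f2) {z : ℝ × ℝ}
    (hz : z ∈ V xA xB yA yC) : 0 ≤ f1 z.1 * f2 z.2 :=
  (mul_pos (H1.dens.1 _ (mem_V.1 hz).1) (H2.dens.1 _ (mem_V.1 hz).2)).le

lemma le_BRev (H1 : BoundedPR xA xB f1) (H2 : BoundedPR yA yC f2) {t : ℝ} (ht : 0 ≤ t) :
    t * ∫ z in {z ∈ V xA xB yA yC | t ≤ z.1 + z.2}, f1 z.1 * f2 z.2
      ≤ BRev xA xB yA yC f1 f2 := by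
  refine le_csSup ⟨max 0 (xB + yC), ?_⟩ ⟨t, ht, rfl⟩
  rintro _ ⟨p, hp, rfl⟩
  rcases le_or_gt p (xB + yC) with hle | hlt
  · have h1 : ∫ z in {z ∈ V xA xB yA yC | p ≤ z.1 + z.2}, f1 z.1 * f2 z.2 ≤ 1 := by
      rw [← setIntegral_density H1 H2]
      exact setIntegral_mono_set (integrableOn_density H1 H2)
        ((ae_restrict_iff' measurableSet_Icc).2 (.of_forall fun z hz => density_nonneg H1 H2 hz))
        (sep_subset _ _).eventuallyLE
    exact le_max_of_le_right ((mul_le_of_le_one_right hp h1).trans hle)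
  · have h1 : {z ∈ V xA xB yA yC | p ≤ z.1 + z.2} = ∅ := by
      refine eq_empty_of_forall_notMem fun z hz => ?_
      have := mem_V.1 hz.1
      linarith [hz.2, this.1.2, this.2.2]
    simp [h1]

lemma Rev_menu_le (hxA : 0 ≤ xA) (hyA : 0 ≤ yA) (H1 : BoundedPR xA xB f1)
    (H2 : BoundedPR yA yC f2) {p : ℝ × ℝ × ℝ × ℝ} (hp : p ∈ menuBox xB yC) :
    Rev xA xB yA yC f1 f2 (menu p) ≤ 2 * BRev xA xB yA yC f1 f2 := by
  have hu : Feasible xA xB yA yC (menu p) := feasible_menu hp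
  obtain ⟨q, t, q', t'⟩ := p
  obtain ⟨hq, ht, hq', ht'⟩ := mem_menuBox.1 hp
  have hm : ∀ s : ℝ, MeasurableSet {z : ℝ × ℝ | s ≤ z.1 + z.2} := fun s =>
    measurableSet_le measurable_const (measurable_fst.add measurable_snd)
  have hi : ∀ s : ℝ, IntegrableOn ({z : ℝ × ℝ | s ≤ z.1 + z.2}.indicator
      fun z => s * (f1 z.1 * f2 z.2)) (V xA xB yA yC) := fun s =>
    (Integrable.const_mul (integrableOn_density H1 H2) s).indicator (hm s)
  have hB : ∀ s : ℝ, 0 ≤ s → ∫ z in V xA xB yA yC, {z : ℝ × ℝ | s ≤ z.1 + z.2}.indicator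
      (fun z => s * (f1 z.1 * f2 z.2)) z ≤ BRev xA xB yA yC f1 f2 := fun s hs => by
    rw [setIntegral_indicator (hm s), integral_const_mul]
    exact le_BRev H1 H2 hs
  have hle : Rev xA xB yA yC f1 f2 (menu (q, t, q', t'))
      ≤ ∫ z in V xA xB yA yC, ({z : ℝ × ℝ | t ≤ z.1 + z.2}.indicator
          (fun z => t * (f1 z.1 * f2 z.2)) z
        + {z : ℝ × ℝ | t' ≤ z.1 + z.2}.indicator (fun z => t' * (f1 z.1 * f2 z.2)) z) := by
    have hr := hu.integrable_rev H1 H2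
    have hae := hu.ae_differentiableAt
    rw [← restrict_V] at hr hae
    refine integral_mono_ae hr ((hi t).add (hi t')) ?_
    filter_upwards [hae] with z hz
    have hzV := interior_subset hz.1
    have hf := density_nonneg H1 H2 hzV
    have hx := hxA.trans (mem_V.1 hzV).1.1
    have hy := hyA.trans (mem_V.1 hzV).2.1
    have n1 : 0 ≤ {z : ℝ × ℝ | t ≤ z.1 + z.2}.indicator (fun z => t * (f1 z.1 * f2 z.2)) z :=
      indicator_apply_nonneg fun _ => mul_nonneg ht.1 hf
    have n2 : 0 ≤ {z : ℝ × ℝ | t' ≤ z.1 + z.2}.indicator (fun z => t' * (f1 z.1 * f2 z.2)) z :=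
      indicator_apply_nonneg fun _ => mul_nonneg ht'.1 hf
    have hnn : 0 ≤ menu (q, t, q', t') z := le_max_left _ _
    have hmenu : menu (q, t, q', t') z = 0 ∨ menu (q, t, q', t') z = q * z.1 + 1 * z.2 - t ∨
        menu (q, t, q', t') z = 1 * z.1 + q' * z.2 - t' := by
      simp only [menu, one_mul]
      rcases max_choice 0 (max (q * z.1 + z.2 - t) (z.1 + q' * z.2 - t')) with h | h
      · exact .inl h
      · rw [h]
        exact .inr (max_choice _ _)
    rcases hmenu with h | h | h
    · have := payment_eq_of_active (q := 0) (q' := 0) (t := 0) hz.2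
        (fun w => by simp [menu]) (by simpa using h)
      rw [this, zero_mul]
      exact add_nonneg n1 n2
    · have := payment_eq_of_active hz.2 (fun w => by
        rw [one_mul]; exact le_max_of_le_right (le_max_left _ _)) h
      rw [this, indicator_of_mem (show z ∈ {z : ℝ × ℝ | t ≤ z.1 + z.2} from ?_)]
      · exact le_add_of_nonneg_right n2
      · have := mul_le_of_le_one_left hx hq.2
        rw [mem_ofPred_eq]
        linarith
    · have := payment_eq_of_active hz.2 (fun w => by
        rw [one_mul]; exact le_max_of_le_right (le_max_right _ _)) h
      rw [this, indicator_of_mem (show z ∈ {z : ℝ × ℝ | t' ≤ z.1 + z.2} from ?_) (fun z => t' * _)]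
      · exact le_add_of_nonneg_left n1
      · have := mul_le_of_le_one_left hy hq'.2
        rw [mem_ofPred_eq]
        linarith
  rw [integral_add (hi t) (hi t')] at hle
  linarith [hB t ht.1, hB t' ht'.1]

end Menu

/-- under Conditions 2 and 4, some mechanism with at most 3 menu items
(two of them non-zero) is optimal, and bundling 2-approximates optimal revenue. -/
theorem stmt14 (xA xB yA yC : ℝ) (h0 : 0 ≤ xA) (h1 : xA < xB) (h2 : 0 ≤ yA) (h3 : yA < yC)
    (f1 f2 : ℝ → ℝ) (hf1 : Density xA xB f1) (hf2 : Density yA yC f2)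
    (hC2 : ∀ x ∈ Set.Icc xA xB, ∀ y ∈ Set.Icc yA yC, -3 ≤ PR f1 x + PR f2 y)
    (hC4a : ∀ x ∈ Set.Icc xA xB, -2 ≤ PR f1 x ∧ PR f1 x ≤ yA * f2 yA - 2)
    (hC4b : ∀ y ∈ Set.Icc yA yC, -2 ≤ PR f2 y ∧ PR f2 y ≤ xA * f1 xA - 2) :
    (∃ q1 ∈ Set.Icc (0:ℝ) 1, ∃ q2 ∈ Set.Icc (0:ℝ) 1,
      ∃ q1' ∈ Set.Icc (0:ℝ) 1, ∃ q2' ∈ Set.Icc (0:ℝ) 1, ∃ t t' : ℝ,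
      Optimal xA xB yA yC f1 f2 (fun z =>
        max 0 (max (q1 * z.1 + q2 * z.2 - t) (q1' * z.1 + q2' * z.2 - t')))) ∧
    OptRev xA xB yA yC f1 f2 ≤ 2 * BRev xA xB yA yC f1 f2 := by
  have H1 : BoundedPR xA xB f1 := ⟨h1, hf1, _, fun x hx =>
    abs_le_max_abs_abs (hC4a x hx).1 (hC4a x hx).2⟩
  have H2 : BoundedPR yA yC f2 := ⟨h3, hf2, _, fun y hy =>
    abs_le_max_abs_abs (hC4b y hy).1 (hC4b y hy).2⟩
  have hne : (menuBox xB yC).Nonempty := ⟨(0, 0, 0, 0), mem_menuBox.2 ⟨⟨le_rfl, zero_le_one⟩,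
    ⟨le_rfl, by linarith⟩, ⟨le_rfl, zero_le_one⟩, ⟨le_rfl, by linarith⟩⟩⟩
  have hcpt : IsCompact (menuBox xB yC) := isCompact_Icc
  obtain ⟨p, hp, hmax⟩ := hcpt.exists_isMaxOn hne (continuousOn_Rev_menu h0 h2 H1 H2)
  have hopt : Rev xA xB yA yC f1 f2 (menu p) = OptRev xA xB yA yC f1 f2 := by
    suffices h : IsGreatest {r | ∃ u, Feasible xA xB yA yC u ∧ r = Rev xA xB yA yC f1 f2 u}
        (Rev xA xB yA yC f1 f2 (menu p)) from h.csSup_eq.symm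
    refine ⟨⟨menu p, feasible_menu hp, rfl⟩, ?_⟩
    rintro _ ⟨u, hu, rfl⟩
    obtain ⟨p', hp', hle⟩ := hu.exists_Rev_le_menu h0 h2 H1 H2 hC2 hC4a hC4b
    exact hle.trans (hmax hp')
  refine ⟨?_, hopt ▸ Rev_menu_le h0 h2 H1 H2 hp⟩
  obtain ⟨q, t, q', t'⟩ := p
  obtain ⟨hq, -, hq', -⟩ := mem_menuBox.1 hp
  refine ⟨q, hq, 1, ⟨zero_le_one, le_rfl⟩, 1, ⟨zero_le_one, le_rfl⟩, q', hq', t, t', ?_⟩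
  simp only [one_mul]
  exact ⟨feasible_menu hp, hopt⟩
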